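/- Consider a pure jump Markov process on ℝ^d with data (λ,k,P₀), generator L, and time marginals {P_t}, with λ̄:=sup_x λ(x)<∞. Let f:ℝ^d→ℝ̄ be measurable and let 0≤s≤t be such that ∫ₛᵗ ∫∫ λ(x)|f(y)−f(x)| k(x,dy) P_r(dx) dr < +∞. Then ∫ f dP_t − ∫ f dP_s is well defined and finite, and ∫ f dP_t − ∫ f dP_s = ∫ₛᵗ ∫ Lf(x) P_r(dx) dr. -/

import Mathlib

open MeasureTheory ProbabilityTheory
open scoped ENNReal

/-- The measure `P_{n,t}` of the pure jump Markov process, defined recursively over the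
last jump time. -/
noncomputable def jumpMarginalN {E : Type*} [MeasurableSpace E]
    (l : E → ℝ) (k : Kernel E E) (P0 : Measure E) : ℕ → ℝ → Measure E
  | 0, t => P0.withDensity fun x => ENNReal.ofReal (Real.exp (-(l x) * t))
  | n + 1, t =>
      (volume.restrict (Set.Icc (0:ℝ) t)).bind fun s =>
        ((jumpMarginalN l k P0 n s).withDensity fun x => ENNReal.ofReal (l x)).bind
          fun x => (k x).withDensity fun y => ENNReal.ofReal (Real.exp (-(l y) * (t - s)))

/-- The time-`t` marginal `P_t = Σ_n P_{n,t}`. -/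
noncomputable def jumpMarginal {E : Type*} [MeasurableSpace E]
    (l : E → ℝ) (k : Kernel E E) (P0 : Measure E) (t : ℝ) : Measure E :=
  Measure.sum fun n => jumpMarginalN l k P0 n t

/-- The generator `Lf(x) = λ(x) ∫ (f(y) - f(x)) k(x,dy)`. -/
noncomputable def jumpGen {E : Type*} [MeasurableSpace E]
    (l : E → ℝ) (k : Kernel E E) (f : E → ℝ) (x : E) : ℝ :=
  l x * ∫ y, (f y - f x) ∂(k x)

section JumpProcess

variable {E : Type*} [MeasurableSpace E]

theorem ProbabilityTheory.Kernel.snd_compProd_eq_bind {α β γ : Type*} [MeasurableSpace α]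
    [MeasurableSpace β] [MeasurableSpace γ] (κ : Kernel α β) [IsSFiniteKernel κ]
    (η : Kernel (α × β) γ) [IsSFiniteKernel η] (a : α) :
    Kernel.snd (κ ⊗ₖ η) a = (κ a).bind fun b => η (a, b) := by
  ext s hs
  rw [Kernel.snd_apply' _ _ hs, Kernel.compProd_apply (hs.preimage measurable_snd),
    Measure.bind_apply hs (Measurable.aemeasurable (by fun_prop))]
  rfl

variable {l : E → ℝ} {k : Kernel E E} {P0 : Measure E}

theorem exists_kernel_jump_then_survive [IsSFiniteKernel k] (hl : Measurable l)
    (κ : Kernel ℝ E) [IsSFiniteKernel κ] :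
    ∃ θ : Kernel (ℝ × ℝ) E, IsSFiniteKernel θ ∧ ∀ t s, θ (t, s) =
      ((κ s).withDensity fun x => ENNReal.ofReal (l x)).bind
        fun x => (k x).withDensity fun y => ENNReal.ofReal (Real.exp (-(l y) * (t - s))) := by
  let κ' : Kernel (ℝ × ℝ) E :=
    (κ.comap Prod.snd measurable_snd).withDensity fun _ x => ENNReal.ofReal (l x)
  let η : Kernel ((ℝ × ℝ) × E) E := (k.comap Prod.snd measurable_snd).withDensity
    fun p y => ENNReal.ofReal (Real.exp (-(l y) * (p.1.1 - p.1.2)))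
  have : IsSFiniteKernel κ' := Kernel.IsSFiniteKernel.withDensity _ fun _ _ => ENNReal.ofReal_ne_top
  have : IsSFiniteKernel η := Kernel.IsSFiniteKernel.withDensity _ fun _ _ => ENNReal.ofReal_ne_top
  refine ⟨Kernel.snd (κ' ⊗ₖ η), inferInstance, fun t s => ?_⟩
  rw [Kernel.snd_compProd_eq_bind, Kernel.withDensity_apply _ (by fun_prop)]
  congr 1
  ext1 x
  rw [Kernel.withDensity_apply _ (by fun_prop)]
  rfl

theorem exists_kernel_jumpMarginalN [IsSFiniteKernel k] [SFinite P0] (hl : Measurable l) (n : ℕ) :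
    ∃ κ : Kernel ℝ E, IsSFiniteKernel κ ∧ ∀ t, κ t = jumpMarginalN l k P0 n t := by
  induction n with
  | zero =>
    refine ⟨(Kernel.const ℝ P0).withDensity fun t x => ENNReal.ofReal (Real.exp (-(l x) * t)),
      Kernel.IsSFiniteKernel.withDensity _ fun _ _ => ENNReal.ofReal_ne_top, fun t => ?_⟩
    rw [Kernel.withDensity_apply _ (by fun_prop)]
    rfl
  | succ n ih =>
    obtain ⟨κ, _, hκ⟩ := ih
    obtain ⟨θ, _, hθ⟩ := exists_kernel_jump_then_survive (k := k) hl κ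
    let ind : ℝ → ℝ → ℝ≥0∞ := fun t s => if s ∈ Set.Icc 0 t then 1 else 0
    have hind : Measurable (Function.uncurry ind) := by
      refine Measurable.ite ?_ measurable_const measurable_const
      exact (measurableSet_le measurable_const measurable_snd).inter
        (measurableSet_le measurable_snd measurable_fst)
    let τ : Kernel ℝ ℝ := (Kernel.const ℝ volume).withDensity ind
    have : IsSFiniteKernel τ := Kernel.IsSFiniteKernel.withDensity _ fun t s => by
      unfold ind; split_ifs <;> simp
    refine ⟨Kernel.snd (τ ⊗ₖ θ), inferInstance, fun t => ?_⟩
    rw [Kernel.snd_compProd_eq_bind, Kernel.withDensity_apply _ hind]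
    have : (Kernel.const ℝ (volume : Measure ℝ) t).withDensity (ind t) =
        volume.restrict (Set.Icc 0 t) := by
      rw [← withDensity_indicator_one measurableSet_Icc, Kernel.const_apply]
      congr 1
      ext s
      simp [ind, Set.indicator]
    simp only [this, hθ, hκ, jumpMarginalN]

theorem lintegral_jumpMarginalN_zero (hl : Measurable l) (t : ℝ) {g : E → ℝ≥0∞}
    (hg : Measurable g) :
    ∫⁻ x, g x ∂jumpMarginalN l k P0 0 t =
      ∫⁻ x, ENNReal.ofReal (Real.exp (-(l x) * t)) * g x ∂P0 := by
  rw [jumpMarginalN, lintegral_withDensity_eq_lintegral_mul _ (by fun_prop) hg]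
  rfl

theorem lintegral_jumpMarginalN_succ [IsSFiniteKernel k] [SFinite P0] (hl : Measurable l) (n : ℕ)
    (t : ℝ) {g : E → ℝ≥0∞} (hg : Measurable g) :
    ∫⁻ x, g x ∂jumpMarginalN l k P0 (n + 1) t =
      ∫⁻ s in Set.Icc 0 t, ∫⁻ x, ENNReal.ofReal (l x) *
        ∫⁻ y, ENNReal.ofReal (Real.exp (-(l y) * (t - s))) * g y ∂k x
          ∂jumpMarginalN l k P0 n s := by
  obtain ⟨κ, _, hκ⟩ := exists_kernel_jumpMarginalN (k := k) (P0 := P0) hl n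
  obtain ⟨θ, _, hθ⟩ := exists_kernel_jump_then_survive (k := k) hl κ
  simp only [jumpMarginalN, ← hκ, ← hθ]
  rw [Measure.lintegral_bind (Measurable.aemeasurable (by fun_prop))
    hg.aemeasurable]
  refine lintegral_congr fun s => ?_
  have hw : Measurable (Function.uncurry fun (_ : E) (y : E) =>
      ENNReal.ofReal (Real.exp (-(l y) * (t - s)))) := by fun_prop
  have hk : (fun x => (k x).withDensity fun y => ENNReal.ofReal (Real.exp (-(l y) * (t - s)))) =
      k.withDensity fun _ y => ENNReal.ofReal (Real.exp (-(l y) * (t - s))) := by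
    ext1 x
    rw [Kernel.withDensity_apply _ hw]
  rw [hθ, hk, Measure.lintegral_bind (Kernel.aemeasurable _) hg.aemeasurable]
  simp_rw [Kernel.lintegral_withDensity k hw _ hg]
  rw [lintegral_withDensity_eq_lintegral_mul _ (by fun_prop)]
  · rfl
  · exact Measurable.lintegral_kernel_prod_right (by fun_prop)

theorem lintegral_Icc_rate_mul_exp {c : ℝ} (hc : 0 ≤ c) {a b : ℝ} (hab : a ≤ b) :
    ∫⁻ r in Set.Icc a b, ENNReal.ofReal (c * Real.exp (-c * (r - a))) =
      ENNReal.ofReal (1 - Real.exp (-c * (b - a))) := by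
  have hcont : Continuous fun r : ℝ => c * Real.exp (-c * (r - a)) := by fun_prop
  rw [← ofReal_integral_eq_lintegral_ofReal (hcont.integrableOn_Icc)
    (.of_forall fun r => by positivity), integral_Icc_eq_integral_Ioc,
    ← intervalIntegral.integral_of_le hab,
    intervalIntegral.integral_eq_sub_of_hasDerivAt (f := fun r => -Real.exp (-c * (r - a)))
      (fun r _ => ?_) (hcont.intervalIntegrable _ _)]
  · congr 1
    simp
    ring
  · refine ((((hasDerivAt_id r).sub_const a).const_mul (-c)).exp.neg).congr_deriv ?_
    simp only [id_eq]
    ring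

theorem lintegral_lintegral_Icc_swap {F : ℝ → ℝ → ℝ≥0∞} (hF : Measurable (Function.uncurry F))
    (a b : ℝ) :
    ∫⁻ r in Set.Icc a b, ∫⁻ s in Set.Icc a r, F r s =
      ∫⁻ s in Set.Icc a b, ∫⁻ r in Set.Icc s b, F r s := by
  have hm : MeasurableSet {p : ℝ × ℝ | p.2 ≤ p.1} := measurableSet_le measurable_snd measurable_fst
  have hG : Measurable (Function.uncurry fun r s => (Set.Iic r).indicator (F r) s) := by
    convert hF.indicator hm using 1
    ext ⟨r, s⟩
    simp [Function.uncurry, Set.indicator]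
  calc ∫⁻ r in Set.Icc a b, ∫⁻ s in Set.Icc a r, F r s
      = ∫⁻ r in Set.Icc a b, ∫⁻ s in Set.Icc a b, (Set.Iic r).indicator (F r) s := by
        refine setLIntegral_congr_fun measurableSet_Icc fun r hr => ?_
        rw [lintegral_indicator measurableSet_Iic, Measure.restrict_restrict measurableSet_Iic]
        congr 2
        ext s
        simp only [Set.mem_Icc, Set.mem_inter_iff, Set.mem_Iic]
        exact ⟨fun h => ⟨h.2, h.1, h.2.trans hr.2⟩, fun h => ⟨h.2.1, h.1⟩⟩
    _ = ∫⁻ s in Set.Icc a b, ∫⁻ r in Set.Icc a b, (Set.Iic r).indicator (F r) s :=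
        lintegral_lintegral_swap hG.aemeasurable
    _ = _ := by
        refine setLIntegral_congr_fun measurableSet_Icc fun s hs => ?_
        have : (fun r => (Set.Iic r).indicator (F r) s) = (Set.Ici s).indicator fun r => F r s := by
          ext r
          simp [Set.indicator]
        simp only [this]
        rw [lintegral_indicator measurableSet_Ici, Measure.restrict_restrict measurableSet_Ici]
        congr 2
        ext r
        simp only [Set.mem_Icc, Set.mem_inter_iff, Set.mem_Ici]
        exact ⟨fun h => ⟨h.1, h.2.2⟩, fun h => ⟨h.1, hs.1.trans h.1, h.2⟩⟩

theorem lintegral_Icc_exp_mul_rate {c : ℝ} (hc : 0 ≤ c) {a b : ℝ} (hab : a ≤ b) (v : ℝ≥0∞) :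
    ∫⁻ r in Set.Icc a b, ENNReal.ofReal (Real.exp (-c * (r - a))) * (ENNReal.ofReal c * v) =
      ENNReal.ofReal (1 - Real.exp (-c * (b - a))) * v := by
  rw [← lintegral_Icc_rate_mul_exp hc hab, ← lintegral_mul_const _ (by fun_prop)]
  refine lintegral_congr fun r => ?_
  rw [ENNReal.ofReal_mul hc]
  ring

theorem ofReal_exp_mul_add {c u : ℝ} (hc : 0 ≤ c) (hu : 0 ≤ u) (v : ℝ≥0∞) :
    ENNReal.ofReal (Real.exp (-c * u)) * v + ENNReal.ofReal (1 - Real.exp (-c * u)) * v = v := by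
  have : Real.exp (-c * u) ≤ 1 := Real.exp_le_one_iff.2 (by nlinarith [mul_nonneg hc hu])
  rw [← add_mul, ← ENNReal.ofReal_add (Real.exp_nonneg _) (by linarith)]
  simp

theorem lintegral_jumpMarginalN_zero_add [SFinite P0] (hl : Measurable l) (hl0 : ∀ x, 0 ≤ l x)
    {t : ℝ} (ht : 0 ≤ t) {g : E → ℝ≥0∞} (hg : Measurable g) :
    ∫⁻ x, g x ∂jumpMarginalN l k P0 0 t +
      ∫⁻ r in Set.Icc 0 t, ∫⁻ x, ENNReal.ofReal (l x) * g x ∂jumpMarginalN l k P0 0 r =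
      ∫⁻ x, g x ∂P0 := by
  rw [lintegral_jumpMarginalN_zero hl t hg]
  simp_rw [lintegral_jumpMarginalN_zero (g := fun x => ENNReal.ofReal (l x) * g x) hl _
    (by fun_prop)]
  rw [lintegral_lintegral_swap (by fun_prop), ← lintegral_add_left (by fun_prop)]
  refine lintegral_congr fun x => ?_
  have h := lintegral_Icc_exp_mul_rate (hl0 x) ht (g x)
  simp only [sub_zero] at h
  rw [h, ofReal_exp_mul_add (hl0 x) ht]

theorem lintegral_jumpMarginalN_succ_add [IsSFiniteKernel k] [SFinite P0] (hl : Measurable l)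
    (hl0 : ∀ x, 0 ≤ l x) (n : ℕ) {t : ℝ} {g : E → ℝ≥0∞} (hg : Measurable g) :
    ∫⁻ x, g x ∂jumpMarginalN l k P0 (n + 1) t +
      ∫⁻ r in Set.Icc 0 t, ∫⁻ x, ENNReal.ofReal (l x) * g x ∂jumpMarginalN l k P0 (n + 1) r =
      ∫⁻ r in Set.Icc 0 t, ∫⁻ x, ENNReal.ofReal (l x) * ∫⁻ y, g y ∂k x
        ∂jumpMarginalN l k P0 n r := by
  obtain ⟨κ, _, hκ⟩ := exists_kernel_jumpMarginalN (k := k) (P0 := P0) hl n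
  rw [lintegral_jumpMarginalN_succ hl n t hg]
  simp_rw [lintegral_jumpMarginalN_succ (g := fun x => ENNReal.ofReal (l x) * g x) hl n _
    (by fun_prop : Measurable fun x => ENNReal.ofReal (l x) * g x), ← hκ]
  have hinner {w : ℝ × ℝ → E → ℝ≥0∞} (hw : Measurable (Function.uncurry w)) :
      Measurable fun q : (ℝ × ℝ) × E => ENNReal.ofReal (l q.2) * ∫⁻ y, w q.1 y ∂k q.2 := by
    refine Measurable.mul (by fun_prop) ?_
    exact Measurable.lintegral_kernel_prod_right' (κ := k.comap Prod.snd measurable_snd)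
      (f := fun p : ((ℝ × ℝ) × E) × E => w p.1.1 p.2) (by fun_prop)
  have houter {w : ℝ × ℝ → E → ℝ≥0∞} (hw : Measurable (Function.uncurry w)) :
      Measurable fun p : ℝ × ℝ =>
        ∫⁻ x, ENNReal.ofReal (l x) * ∫⁻ y, w p y ∂k x ∂κ p.2 :=
    Measurable.lintegral_kernel_prod_right' (κ := κ.comap Prod.snd measurable_snd) (hinner hw)
  have hsurvive : Measurable fun s => ∫⁻ x, ENNReal.ofReal (l x) *
      ∫⁻ y, ENNReal.ofReal (Real.exp (-(l y) * (t - s))) * g y ∂k x ∂κ s :=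
    (houter (w := fun p y => ENNReal.ofReal (Real.exp (-(l y) * (p.1 - p.2))) * g y)
      (by fun_prop)).comp (measurable_prodMk_left (x := t))
  rw [lintegral_lintegral_Icc_swap (F := fun r s => ∫⁻ x, ENNReal.ofReal (l x) *
        ∫⁻ y, ENNReal.ofReal (Real.exp (-(l y) * (r - s))) * (ENNReal.ofReal (l y) * g y) ∂k x ∂κ s)
      (houter (w := fun p y =>
      ENNReal.ofReal (Real.exp (-(l y) * (p.1 - p.2))) * (ENNReal.ofReal (l y) * g y))
      (by fun_prop)),
    ← lintegral_add_left hsurvive]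
  refine setLIntegral_congr_fun measurableSet_Icc fun s hs => ?_
  have hswap : ∫⁻ r in Set.Icc s t, ∫⁻ x, ENNReal.ofReal (l x) *
        ∫⁻ y, ENNReal.ofReal (Real.exp (-(l y) * (r - s))) * (ENNReal.ofReal (l y) * g y) ∂k x
          ∂κ s =
      ∫⁻ x, ENNReal.ofReal (l x) *
        ∫⁻ y, ENNReal.ofReal (1 - Real.exp (-(l y) * (t - s))) * g y ∂k x ∂κ s := by
    have hm := hinner (w := fun p y =>
      ENNReal.ofReal (Real.exp (-(l y) * (p.1 - p.2))) * (ENNReal.ofReal (l y) * g y))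
      (by fun_prop)
    have hm' : Measurable fun q : ℝ × E => ENNReal.ofReal (l q.2) *
        ∫⁻ y, ENNReal.ofReal (Real.exp (-(l y) * (q.1 - s))) * (ENNReal.ofReal (l y) * g y)
          ∂k q.2 :=
      hm.comp (f := fun q : ℝ × E => ((q.1, s), q.2)) (by fun_prop)
    rw [lintegral_lintegral_swap hm'.aemeasurable]
    refine lintegral_congr fun x => ?_
    rw [lintegral_const_mul' _ _ ENNReal.ofReal_ne_top, lintegral_lintegral_swap (by fun_prop)]
    congr 1
    exact lintegral_congr fun y => lintegral_Icc_exp_mul_rate (hl0 y) hs.2 (g y)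
  have hm : Measurable fun x => ENNReal.ofReal (l x) *
      ∫⁻ y, ENNReal.ofReal (Real.exp (-(l y) * (t - s))) * g y ∂k x :=
    Measurable.mul (by fun_prop) (Measurable.lintegral_kernel (by fun_prop))
  rw [hswap, ← lintegral_add_left hm]
  refine lintegral_congr fun x => ?_
  rw [← mul_add, ← lintegral_add_left (by fun_prop)]
  congr 1
  exact lintegral_congr fun y => ofReal_exp_mul_add (hl0 y) (sub_nonneg.2 hs.2) (g y)

theorem exists_kernel_jumpMarginal [IsSFiniteKernel k] [SFinite P0] (hl : Measurable l) :
    ∃ κ : Kernel ℝ E, IsSFiniteKernel κ ∧ ∀ t, κ t = jumpMarginal l k P0 t := by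
  choose κ hκ h using exists_kernel_jumpMarginalN (k := k) (P0 := P0) hl
  exact ⟨Kernel.sum κ, inferInstance, fun t => by simp_rw [Kernel.sum_apply, h]; rfl⟩

theorem lintegral_Icc_jumpMarginal [IsSFiniteKernel k] [SFinite P0] (hl : Measurable l) (a b : ℝ)
    {g : E → ℝ≥0∞} (hg : Measurable g) :
    ∫⁻ r in Set.Icc a b, ∫⁻ x, g x ∂jumpMarginal l k P0 r =
      ∑' n, ∫⁻ r in Set.Icc a b, ∫⁻ x, g x ∂jumpMarginalN l k P0 n r := by
  simp_rw [jumpMarginal, lintegral_sum_measure]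
  refine lintegral_tsum fun n => ?_
  obtain ⟨κ, _, hκ⟩ := exists_kernel_jumpMarginalN (k := k) (P0 := P0) hl n
  simp_rw [← hκ]
  exact (hg.lintegral_kernel (κ := κ)).aemeasurable

theorem lintegral_jumpMarginal_add [IsSFiniteKernel k] [SFinite P0] (hl : Measurable l)
    (hl0 : ∀ x, 0 ≤ l x) {t : ℝ} (ht : 0 ≤ t) {g : E → ℝ≥0∞} (hg : Measurable g) :
    ∫⁻ x, g x ∂jumpMarginal l k P0 t +
      ∫⁻ r in Set.Icc 0 t, ∫⁻ x, ENNReal.ofReal (l x) * g x ∂jumpMarginal l k P0 r =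
      ∫⁻ x, g x ∂P0 + ∫⁻ r in Set.Icc 0 t, ∫⁻ x, ENNReal.ofReal (l x) * ∫⁻ y, g y ∂k x
        ∂jumpMarginal l k P0 r := by
  rw [lintegral_Icc_jumpMarginal hl _ _ (by fun_prop),
    lintegral_Icc_jumpMarginal (g := fun x => ENNReal.ofReal (l x) * ∫⁻ y, g y ∂k x) hl _ _
      (Measurable.mul (by fun_prop) hg.lintegral_kernel),
    jumpMarginal, lintegral_sum_measure, ← ENNReal.tsum_add, tsum_eq_zero_add' ENNReal.summable,
    lintegral_jumpMarginalN_zero_add hl hl0 ht hg]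
  simp_rw [lintegral_jumpMarginalN_succ_add hl hl0 _ hg]

theorem jumpMarginal_univ_le [IsMarkovKernel k] [SFinite P0] (hl : Measurable l)
    (hl0 : ∀ x, 0 ≤ l x) {t : ℝ} (ht : 0 ≤ t) :
    jumpMarginal l k P0 t Set.univ ≤ P0 Set.univ := by
  rw [jumpMarginal, Measure.sum_apply _ MeasurableSet.univ]
  refine ENNReal.tsum_le_of_sum_range_le fun N => ?_
  have key : ∀ N, ∑ n ∈ Finset.range (N + 1), jumpMarginalN l k P0 n t Set.univ +
      ∫⁻ r in Set.Icc 0 t, ∫⁻ x, ENNReal.ofReal (l x) ∂jumpMarginalN l k P0 N r =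
      P0 Set.univ := fun N => by
    induction N with
    | zero =>
      simpa using lintegral_jumpMarginalN_zero_add (k := k) (P0 := P0) hl hl0 ht
        (measurable_const (a := (1 : ℝ≥0∞)))
    | succ N ih =>
      have h := lintegral_jumpMarginalN_succ_add (k := k) (P0 := P0) (t := t) hl hl0 N
        (measurable_const (a := (1 : ℝ≥0∞)))
      simp only [lintegral_const, measure_univ, one_mul, mul_one] at h
      rw [Finset.sum_range_succ, add_assoc, h, ih]
  calc ∑ n ∈ Finset.range N, jumpMarginalN l k P0 n t Set.univ
      ≤ ∑ n ∈ Finset.range (N + 1), jumpMarginalN l k P0 n t Set.univ :=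
        Finset.sum_le_sum_of_subset (by simp)
    _ ≤ P0 Set.univ := (key N).le.trans' le_self_add

theorem lintegral_Icc_lintegral_rate_mul_lt_top [IsMarkovKernel k] [IsFiniteMeasure P0]
    (hl : Measurable l) (hl0 : ∀ x, 0 ≤ l x) {lbar : ℝ} (hlbar : ∀ x, l x ≤ lbar)
    {a b : ℝ} (ha : 0 ≤ a) {g : E → ℝ≥0∞} (hg : ∀ x, g x ≤ 1) :
    ∫⁻ r in Set.Icc a b, ∫⁻ x, ENNReal.ofReal (l x) * g x ∂jumpMarginal l k P0 r < ⊤ := by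
  calc ∫⁻ r in Set.Icc a b, ∫⁻ x, ENNReal.ofReal (l x) * g x ∂jumpMarginal l k P0 r
      ≤ ∫⁻ _ in Set.Icc a b, ENNReal.ofReal lbar * P0 Set.univ := by
        refine setLIntegral_mono' measurableSet_Icc fun r hr => ?_
        calc ∫⁻ x, ENNReal.ofReal (l x) * g x ∂jumpMarginal l k P0 r
            ≤ ∫⁻ _, ENNReal.ofReal lbar ∂jumpMarginal l k P0 r := lintegral_mono fun x =>
              (mul_le_mul' (ENNReal.ofReal_le_ofReal (hlbar x)) (hg x)).trans_eq (mul_one _)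
          _ ≤ ENNReal.ofReal lbar * P0 Set.univ := by
              rw [lintegral_const]
              exact mul_le_mul_right (jumpMarginal_univ_le hl hl0 (ha.trans hr.1)) _
    _ < ⊤ := by
        rw [setLIntegral_const]
        exact ENNReal.mul_lt_top (ENNReal.mul_lt_top ENNReal.ofReal_lt_top (measure_lt_top _ _))
          (by simp)

/-- Kolmogorov's forward equation on `[s, t]`. -/
theorem lintegral_jumpMarginal_add_Icc [IsMarkovKernel k] [IsFiniteMeasure P0]
    (hl : Measurable l) (hl0 : ∀ x, 0 ≤ l x) {lbar : ℝ} (hlbar : ∀ x, l x ≤ lbar)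
    {s t : ℝ} (hs : 0 ≤ s) (hst : s ≤ t) {g : E → ℝ≥0∞} (hg : Measurable g)
    (hg1 : ∀ x, g x ≤ 1) :
    ∫⁻ x, g x ∂jumpMarginal l k P0 t +
      ∫⁻ r in Set.Icc s t, ∫⁻ x, ENNReal.ofReal (l x) * g x ∂jumpMarginal l k P0 r =
      ∫⁻ x, g x ∂jumpMarginal l k P0 s +
        ∫⁻ r in Set.Icc s t, ∫⁻ x, ENNReal.ofReal (l x) * ∫⁻ y, g y ∂k x
          ∂jumpMarginal l k P0 r := by
  have hsplit (F : ℝ → ℝ≥0∞) : ∫⁻ r in Set.Icc 0 t, F r =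
      (∫⁻ r in Set.Icc 0 s, F r) + ∫⁻ r in Set.Icc s t, F r := by
    rw [← Set.Icc_union_Ioc_eq_Icc hs hst, lintegral_union measurableSet_Ioc,
      restrict_Ioc_eq_restrict_Icc]
    exact Set.disjoint_left.2 fun x (hx : x ∈ Set.Icc 0 s) hx' => hx'.1.not_ge hx.2
  have h0 := lintegral_jumpMarginal_add (k := k) (P0 := P0) hl hl0 hs hg
  have h1 := lintegral_jumpMarginal_add (k := k) (P0 := P0) hl hl0 (hs.trans hst) hg
  rw [hsplit, hsplit] at h1
  have hfin := lintegral_Icc_lintegral_rate_mul_lt_top (k := k) (P0 := P0) (b := s)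
    hl hl0 hlbar le_rfl hg1
  rw [← ENNReal.add_left_inj hfin.ne]
  calc _ = _ := by ring
    _ = _ := h1
    _ = _ := by rw [← add_assoc, ← h0]; ring

/-- If two finite measures differ by the marginals of a transport measure along which `f` has
integrable increments, then the integrals of `f` differ by the integral of these increments. -/
theorem integrable_iff_and_integral_sub_eq_of_add_map_eq {Ω : Type*} [MeasurableSpace Ω] {μ ν : Measure E}
    [IsFiniteMeasure μ] [IsFiniteMeasure ν] {ρ : Measure Ω} [IsFiniteMeasure ρ] {X Y : Ω → E}
    (hX : Measurable X) (hY : Measurable Y) (h : ν + ρ.map X = μ + ρ.map Y) {f : E → ℝ}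
    (hf : Measurable f) (hfi : Integrable (fun ω => f (Y ω) - f (X ω)) ρ) :
    (Integrable f μ ↔ Integrable f ν) ∧
      (Integrable f μ → ∫ x, f x ∂ν - ∫ x, f x ∂μ = ∫ ω, (f (Y ω) - f (X ω)) ∂ρ) := by
  have mono {μ ν : Measure E} {X Y : Ω → E} (hX : Measurable X) (hY : Measurable Y)
      (h : ν + ρ.map X = μ + ρ.map Y) (hfi : Integrable (fun ω => f (Y ω) - f (X ω)) ρ)
      (hμ : Integrable f μ) : Integrable f ν := by
    refine ⟨hf.aestronglyMeasurable, ?_⟩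
    have hle (n : ℕ) : ∫⁻ x, min ‖f x‖ₑ n ∂ν ≤
        ∫⁻ x, ‖f x‖ₑ ∂μ + ∫⁻ ω, ‖f (Y ω) - f (X ω)‖ₑ ∂ρ := by
      have hm : Measurable fun x => min ‖f x‖ₑ (n : ℝ≥0∞) := by fun_prop
      have hfin : ∫⁻ ω, min ‖f (X ω)‖ₑ (n : ℝ≥0∞) ∂ρ ≠ ⊤ := by
        refine ((lintegral_mono fun ω => min_le_right _ _).trans_lt ?_).ne
        rw [lintegral_const]
        exact ENNReal.mul_lt_top (by simp) (measure_lt_top _ _)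
      have heq := congrArg (fun m => ∫⁻ x, min ‖f x‖ₑ (n : ℝ≥0∞) ∂m) h
      simp only [lintegral_add_measure] at heq
      rw [lintegral_map hm hX, lintegral_map hm hY] at heq
      rw [← ENNReal.add_le_add_iff_right hfin, heq, add_assoc, ← lintegral_add_left (by fun_prop)]
      refine add_le_add (lintegral_mono fun x => min_le_left _ _) (lintegral_mono fun ω => ?_)
      have htri : ‖f (Y ω)‖ₑ ≤ ‖f (Y ω) - f (X ω)‖ₑ + ‖f (X ω)‖ₑ := by
        simpa using enorm_add_le (f (Y ω) - f (X ω)) (f (X ω))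
      rw [← min_add_add_left]
      exact le_min ((min_le_left _ _).trans htri) ((min_le_right _ _).trans le_add_self)
    have hsup : ∫⁻ x, ‖f x‖ₑ ∂ν = ⨆ n : ℕ, ∫⁻ x, min ‖f x‖ₑ n ∂ν := by
      rw [← lintegral_iSup (f := fun (n : ℕ) x => min ‖f x‖ₑ (n : ℝ≥0∞)) (fun n => by fun_prop)
        (fun m n hmn x => min_le_min_left _ (by exact_mod_cast hmn))]
      refine lintegral_congr fun x => ?_
      refine le_antisymm ?_ (iSup_le fun n => min_le_left _ _)
      obtain ⟨n, hn⟩ := ENNReal.exists_nat_gt (enorm_ne_top (x := f x))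
      exact le_iSup_of_le n (le_min le_rfl hn.le)
    rw [HasFiniteIntegral, hsup]
    exact (iSup_le hle).trans_lt (ENNReal.add_lt_top.2 ⟨hμ.2, hfi.2⟩)
  have hiff : Integrable f μ ↔ Integrable f ν :=
    ⟨mono hX hY h hfi, mono hY hX h.symm (by simpa [Pi.neg_def] using hfi.neg)⟩
  refine ⟨hiff, fun hμ => ?_⟩
  have hν := hiff.1 hμ
  let φ : ℕ → ℝ → ℝ := fun n x => max (-n) (min x n)
  have hφm (n : ℕ) : Measurable (φ n) := by unfold φ; fun_prop
  have hφb (n : ℕ) (x : ℝ) : |φ n x| ≤ n :=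
    abs_le.2 ⟨le_max_left _ _, max_le (by linarith [n.cast_nonneg (α := ℝ)]) (min_le_right _ _)⟩
  have hφlip (n : ℕ) (x y : ℝ) : |φ n x - φ n y| ≤ |x - y| := by
    have h1 := abs_max_sub_max_le_max (-(n : ℝ)) (min x n) (-n) (min y n)
    have h2 := abs_min_sub_min_le_max x (n : ℝ) y n
    simp only [sub_self, abs_zero, abs_nonneg, sup_of_le_left, sup_of_le_right] at h1 h2
    exact h1.trans h2
  have hφle (n : ℕ) (x : ℝ) : |φ n x| ≤ |x| := by
    simpa [φ] using hφlip n x 0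
  have hφlim (x : ℝ) : Filter.Tendsto (fun n => φ n x) Filter.atTop (nhds x) := by
    refine tendsto_const_nhds.congr' ?_
    filter_upwards [Filter.eventually_ge_atTop ⌈|x|⌉₊] with n hn
    have hx := abs_le.1 ((Nat.le_ceil |x|).trans (Nat.cast_le.2 hn))
    simp [φ, hx.1, hx.2]
  have heq (n : ℕ) : ∫ x, φ n (f x) ∂ν - ∫ x, φ n (f x) ∂μ =
      ∫ ω, (φ n (f (Y ω)) - φ n (f (X ω))) ∂ρ := by
    have hm : Measurable fun x => φ n (f x) := (hφm n).comp hf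
    have hb (m : Measure E) [IsFiniteMeasure m] : Integrable (fun x => φ n (f x)) m :=
      .of_bound hm.aestronglyMeasurable n (.of_forall fun a => hφb n _)
    have hbρ {Z : Ω → E} (hZ : Measurable Z) : Integrable (fun ω => φ n (f (Z ω))) ρ :=
      (integrable_map_measure hm.aestronglyMeasurable hZ.aemeasurable).1 (hb _)
    have := congrArg (fun m => ∫ x, φ n (f x) ∂m) h
    rw [integral_add_measure (hb _) (hb _),
      integral_add_measure (hb _) (hb _),
      integral_map hX.aemeasurable hm.aestronglyMeasurable,
      integral_map hY.aemeasurable hm.aestronglyMeasurable] at this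
    rw [integral_sub (hbρ hY) (hbρ hX)]
    linarith
  have hlim {m : Measure E} (hm : Integrable f m) : Filter.Tendsto
      (fun n => ∫ x, φ n (f x) ∂m) Filter.atTop (nhds (∫ x, f x ∂m)) :=
    tendsto_integral_of_dominated_convergence (fun x => |f x|)
      (fun n => ((hφm n).comp hf).aestronglyMeasurable) hm.abs
      (fun n => .of_forall fun x => hφle n _) (.of_forall fun x => hφlim _)
  have hlimρ : Filter.Tendsto (fun n => ∫ ω, (φ n (f (Y ω)) - φ n (f (X ω))) ∂ρ) Filter.atTop
      (nhds (∫ ω, (f (Y ω) - f (X ω)) ∂ρ)) :=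
    tendsto_integral_of_dominated_convergence (fun ω => |f (Y ω) - f (X ω)|)
      (fun n => (((hφm n).comp (hf.comp hY)).sub
        ((hφm n).comp (hf.comp hX))).aestronglyMeasurable) hfi.abs
      (fun n => .of_forall fun ω => hφlip n _ _) (.of_forall fun ω => (hφlim _).sub (hφlim _))
  refine tendsto_nhds_unique ((hlim hν).sub (hlim hμ)) ?_
  simpa only [heq] using hlimρ

theorem integrable_jumpMarginal_iff_and_integral_sub_eq [IsMarkovKernel k] [IsFiniteMeasure P0]
    (hl : Measurable l) (hl0 : ∀ x, 0 ≤ l x) {lbar : ℝ} (hlbar : ∀ x, l x ≤ lbar)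
    {f : E → ℝ} (hf : Measurable f) {s t : ℝ} (hs : 0 ≤ s) (hst : s ≤ t)
    (hint : ∫⁻ r in Set.Icc s t, ∫⁻ x, ENNReal.ofReal (l x) *
      ∫⁻ y, ENNReal.ofReal |f y - f x| ∂k x ∂jumpMarginal l k P0 r < ⊤) :
    (Integrable f (jumpMarginal l k P0 s) ↔ Integrable f (jumpMarginal l k P0 t)) ∧
    (Integrable f (jumpMarginal l k P0 s) →
      (∫ x, f x ∂(jumpMarginal l k P0 t)) - ∫ x, f x ∂(jumpMarginal l k P0 s)
        = ∫ r in s..t, ∫ x, jumpGen l k f x ∂(jumpMarginal l k P0 r)) := by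
  obtain ⟨κ, _, hκ⟩ := exists_kernel_jumpMarginal (k := k) (P0 := P0) hl
  have hlm : Measurable (Function.uncurry fun (_ : ℝ) x => ENNReal.ofReal (l x)) := by fun_prop
  let Λ : Kernel ℝ E := κ.withDensity fun _ x => ENNReal.ofReal (l x)
  have : IsSFiniteKernel Λ := Kernel.IsSFiniteKernel.withDensity _ fun _ _ => ENNReal.ofReal_ne_top
  let ρ : Measure ((ℝ × E) × E) :=
    ((volume.restrict (Set.Icc s t)) ⊗ₘ Λ) ⊗ₘ (k.comap Prod.snd measurable_snd)
  have hρ {G : E → E → ℝ≥0∞} (hG : Measurable (Function.uncurry G)) :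
      ∫⁻ ω, G ω.1.2 ω.2 ∂ρ = ∫⁻ r in Set.Icc s t,
        ∫⁻ x, ENNReal.ofReal (l x) * ∫⁻ y, G x y ∂k x ∂jumpMarginal l k P0 r := by
    have hG' : Measurable fun x => ∫⁻ y, G x y ∂k x := hG.lintegral_kernel_prod_right
    rw [Measure.lintegral_compProd (by fun_prop)]
    simp only [Kernel.comap_apply]
    rw [Measure.lintegral_compProd (f := fun p => ∫⁻ y, G p.2 y ∂k p.2)
      (hG'.comp measurable_snd)]
    refine lintegral_congr fun r => ?_
    rw [Kernel.lintegral_withDensity κ hlm r hG', hκ]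
  have hX : Measurable fun ω : (ℝ × E) × E => ω.1.2 := by fun_prop
  have hY : Measurable fun ω : (ℝ × E) × E => ω.2 := by fun_prop
  have hfinite {r : ℝ} (hr : 0 ≤ r) : IsFiniteMeasure (jumpMarginal l k P0 r) :=
    ⟨(jumpMarginal_univ_le hl hl0 hr).trans_lt (measure_lt_top _ _)⟩
  have := hfinite hs
  have := hfinite (hs.trans hst)
  have : IsFiniteMeasure ρ := ⟨by
    rw [← lintegral_one, hρ (G := fun _ _ => 1) (by fun_prop)]
    simpa using lintegral_Icc_lintegral_rate_mul_lt_top (k := k) (P0 := P0) (b := t)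
      (g := fun _ => 1) hl hl0 hlbar hs (fun _ => le_rfl)⟩
  have hbalance : jumpMarginal l k P0 t + ρ.map (fun ω => ω.1.2) =
      jumpMarginal l k P0 s + ρ.map (fun ω => ω.2) := by
    ext A hA
    have hg : Measurable (A.indicator (1 : E → ℝ≥0∞)) := measurable_one.indicator hA
    have h := lintegral_jumpMarginal_add_Icc (k := k) (P0 := P0) hl hl0 hlbar hs hst hg
      (Set.indicator_le_self' fun _ _ => zero_le_one)
    have h1 := hρ (G := fun x _ => A.indicator 1 x) (by fun_prop)
    have h2 := hρ (G := fun _ y => A.indicator 1 y) (by fun_prop)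
    simp only [lintegral_const, measure_univ, mul_one] at h1
    rw [← h1, ← h2, ← lintegral_map hg hX, ← lintegral_map hg hY] at h
    simpa only [lintegral_indicator_one hA, Measure.add_apply] using h
  have hfi : Integrable (fun ω : (ℝ × E) × E => f ω.2 - f ω.1.2) ρ := by
    refine ⟨by fun_prop, ?_⟩
    simp only [HasFiniteIntegral, Real.enorm_eq_ofReal_abs]
    rwa [hρ (G := fun x y => ENNReal.ofReal |f y - f x|) (by fun_prop)]
  obtain ⟨hiff, heq⟩ := integrable_iff_and_integral_sub_eq_of_add_map_eq hX hY hbalance hf hfi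
  refine ⟨hiff, fun hμ => (heq hμ).trans ?_⟩
  have hinc : Integrable (fun p : ℝ × E => ∫ y, (f y - f p.2) ∂k p.2)
      ((volume.restrict (Set.Icc s t)) ⊗ₘ Λ) := by
    simpa using Integrable.integral_compProd (a := ())
      (κ := Kernel.const Unit ((volume.restrict (Set.Icc s t)) ⊗ₘ Λ))
      (η := Kernel.prodMkLeft Unit (k.comap Prod.snd measurable_snd)) hfi
  rw [Measure.integral_compProd hfi]
  simp only [Kernel.comap_apply]
  rw [Measure.integral_compProd hinc,
    intervalIntegral.integral_of_le hst, ← integral_Icc_eq_integral_Ioc]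
  refine integral_congr_ae (.of_forall fun r => ?_)
  simp only [Λ]
  rw [Kernel.withDensity_apply _ hlm, hκ, integral_withDensity_eq_integral_toReal_smul
    (by fun_prop) (.of_forall fun _ => ENNReal.ofReal_lt_top)]
  simp only [jumpGen, smul_eq_mul, ENNReal.toReal_ofReal (hl0 _)]

end JumpProcess

/-- Dynkin-type formula: if
`∫ₛᵗ ∫∫ λ(x)|f(y)-f(x)| k(x,dy) P_r(dx) dr < ∞`, then `∫ f dP_t − ∫ f dP_s` is well
defined and finite (`f` is `P_t`-integrable iff it is `P_s`-integrable, and in that case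
the difference of the integrals is finite) and equals `∫ₛᵗ ∫ Lf dP_r dr`. -/
theorem stmt7 {d : ℕ}
    (l : EuclideanSpace ℝ (Fin d) → ℝ)
    (k : Kernel (EuclideanSpace ℝ (Fin d)) (EuclideanSpace ℝ (Fin d))) [IsMarkovKernel k]
    (hl : Measurable l) (hl0 : ∀ x, 0 ≤ l x)
    (lbar : ℝ) (hlbar : ∀ x, l x ≤ lbar)
    (hnofake : ∀ x, ENNReal.ofReal (l x) * k x {x} = 0)
    (P0 : Measure (EuclideanSpace ℝ (Fin d))) [IsProbabilityMeasure P0]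
    (f : EuclideanSpace ℝ (Fin d) → ℝ) (hf : Measurable f)
    (s t : ℝ) (hs : 0 ≤ s) (hst : s ≤ t)
    (hint : ∫⁻ r in Set.Icc s t,
        (∫⁻ x, ENNReal.ofReal (l x) * ∫⁻ y, ENNReal.ofReal |f y - f x| ∂(k x)
          ∂(jumpMarginal l k P0 r)) ∂volume < ⊤) :
    (Integrable f (jumpMarginal l k P0 s) ↔ Integrable f (jumpMarginal l k P0 t)) ∧
    (Integrable f (jumpMarginal l k P0 s) →
      (∫ x, f x ∂(jumpMarginal l k P0 t)) - ∫ x, f x ∂(jumpMarginal l k P0 s)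
        = ∫ r in s..t, ∫ x, jumpGen l k f x ∂(jumpMarginal l k P0 r)) := by
  exact integrable_jumpMarginal_iff_and_integral_sub_eq hl hl0 hlbar hf hs hst hint
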